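/- arXiv:0809.0786 — 6 statements merged into one kernel-verified Lean document; each statement's English description precedes it below -/
import Mathlib

section
/- Let N = {1,…,n}, let X_1,…,X_n be finite sets with |X_i| ≥ 2, and let X = ∏_{i∈N} X_i. Let Δ be a simplicial complex on N containing ∅, with Δ ≠ 2^N, and let g = min{|B| : B ⊆ N, B ∉ Δ}. If m : X → ℤ is nonzero, all Δ-marginals of m vanish, and Σ_{x∈X} max(m(x),0) = 2^{g−1}, then m takes values only in {−1, 0, 1} (i.e. the degree bound 2^{g−1} is attained only by square-free binomials). -/
open Finset in
/-- Two-point bound for tables with total sum zero. -/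
lemma aux_two_mul_abs {α : Type*} [Fintype α] [DecidableEq α] (m : α → ℤ)
    (h : ∑ x, m x = 0) (x : α) : 2 * |m x| ≤ ∑ x, |m x| := by
  have h1 := Finset.add_sum_erase Finset.univ m (Finset.mem_univ x)
  have h2 := Finset.add_sum_erase Finset.univ (fun x => |m x|) (Finset.mem_univ x)
  have h3 := Finset.abs_sum_le_sum_abs m (Finset.univ.erase x)
  have h4 : m x = -∑ x ∈ Finset.univ.erase x, m x := by linarith
  have h5 : |m x| = |∑ x ∈ Finset.univ.erase x, m x| := by
    conv_lhs => rw [h4]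
    rw [abs_neg]
  linarith

/-- All marginals on at most `k` coordinates vanish. -/
def AuxVanish {n : ℕ} {X : Fin n → Type*} [∀ i, Fintype (X i)] [∀ i, DecidableEq (X i)]
    (k : ℕ) (m : (∀ i, X i) → ℤ) : Prop :=
  ∀ B : Finset (Fin n), B.card ≤ k → ∀ z : (∀ i, X i),
    ∑ x : (∀ i, X i), (if ∀ i ∈ B, x i = z i then m x else 0) = 0

lemma AuxVanish.total {n : ℕ} {X : Fin n → Type*} [∀ i, Fintype (X i)] [∀ i, DecidableEq (X i)]
    {k : ℕ} {m : (∀ i, X i) → ℤ} (h : AuxVanish k m) (z : ∀ i, X i) : ∑ x, m x = 0 := by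
  have := h ∅ (by simp) z
  simpa using this

lemma AuxVanish.slice {n : ℕ} {X : Fin n → Type*} [∀ i, Fintype (X i)] [∀ i, DecidableEq (X i)]
    {k : ℕ} {m : (∀ i, X i) → ℤ} (h : AuxVanish (k + 1) m) (j : Fin n) (a : X j) :
    AuxVanish k (fun x => if x j = a then m x else 0) := by
  intro B hB z
  by_cases hj : j ∈ B ∧ z j ≠ a
  · apply Finset.sum_eq_zero
    intro x _
    dsimp only
    split_ifs with h1 h2
    · exact absurd ((h1 j hj.1).symm.trans h2) hj.2
    · rfl
    · rfl
  · have := h (insert j B) ((Finset.card_insert_le _ _).trans (by omega)) (Function.update z j a)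
    refine Eq.trans ?_ this
    apply Finset.sum_congr rfl
    intro x _
    rw [← ite_and]
    refine if_congr ?_ rfl rfl
    constructor
    · rintro ⟨h1, h2⟩ i hi
      by_cases hij : i = j
      · subst hij; simpa using h2
      · rw [Function.update_of_ne hij]
        exact h1 i (Finset.mem_of_mem_insert_of_ne hi hij)
    · intro h1
      have h2 : x j = a := by simpa using h1 j (Finset.mem_insert_self _ _)
      refine ⟨fun i hi => ?_, h2⟩
      by_cases hij : i = j
      · subst hij
        by_contra hne
        exact hj ⟨hi, fun h3 => hne (h2.trans h3.symm)⟩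
      · simpa [Function.update_of_ne hij] using h1 i (Finset.mem_insert_of_mem hi)

lemma aux_main {n : ℕ} {X : Fin n → Type*} [∀ i, Fintype (X i)] [∀ i, DecidableEq (X i)]
    (k : ℕ) : ∀ (m : (∀ i, X i) → ℤ), m ≠ 0 → AuxVanish k m →
      2 ^ (k + 1) ≤ ∑ x, |m x| ∧ (∑ x, |m x| = 2 ^ (k + 1) → ∀ x, |m x| ≤ 1) := by
  induction k with
  | zero =>
    intro m hm h
    obtain ⟨x, hx⟩ := Function.ne_iff.mp hm
    have hx' : 0 < |m x| := abs_pos.mpr hx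
    have ht := aux_two_mul_abs m (h.total x)
    refine ⟨by have := ht x; norm_num; linarith, fun he y => ?_⟩
    have := ht y
    norm_num at he
    linarith
  | succ k ih =>
    intro m hm h
    obtain ⟨x, hx⟩ := Function.ne_iff.mp hm
    have hx : m x ≠ 0 := hx
    obtain ⟨y, hy, hxy⟩ : ∃ y, m y ≠ 0 ∧ x ≠ y := by
      by_contra hc
      push Not at hc
      have := h.total x
      rw [Finset.sum_eq_single x (fun y _ hne => by
        by_contra h0
        exact hne (hc y h0).symm) (by simp)] at this
      exact hx this
    obtain ⟨j, hj⟩ := Function.ne_iff.mp hxy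
    have key : ∀ w : (∀ i, X i), m w ≠ 0 →
        (fun v : (∀ i, X i) => if v j = w j then m v else 0) ≠ 0 := by
      intro w hw h0
      have := congrFun h0 w
      simp at this
      exact hw this
    obtain ⟨a1, a2⟩ := ih _ (key x hx) (h.slice j (x j))
    obtain ⟨b1, b2⟩ := ih _ (key y hy) (h.slice j (y j))
    have hs : ∑ v, |m v| = ∑ v : (∀ i, X i), |if v j = x j then m v else 0|
        + ∑ v : (∀ i, X i), |if v j = y j then m v else 0|
        + ∑ v : (∀ i, X i), |if v j ≠ x j ∧ v j ≠ y j then m v else 0| := by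
      rw [← Finset.sum_add_distrib, ← Finset.sum_add_distrib]
      apply Finset.sum_congr rfl
      intro v _
      by_cases h1 : v j = x j
      · have h2 : v j ≠ y j := fun h2 => hj (h1.symm.trans h2)
        simp [h1, hj]
      · by_cases h2 : v j = y j
        · simp [h2, Ne.symm hj]
        · simp [h1, h2]
    have hr : 0 ≤ ∑ v : (∀ i, X i), |if v j ≠ x j ∧ v j ≠ y j then m v else 0| :=
      Finset.sum_nonneg fun _ _ => abs_nonneg _
    have hp : (2 : ℤ) ^ (k + 1 + 1) = 2 * 2 ^ (k + 1) := by ring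
    refine ⟨by linarith, fun he w => ?_⟩
    by_cases h1 : w j = x j
    · have := a2 (by linarith) w
      simpa [h1] using this
    · by_cases h2 : w j = y j
      · have := b2 (by linarith) w
        simpa [h2] using this
      · have := Finset.single_le_sum (f := fun v : (∀ i, X i) =>
          |if v j ≠ x j ∧ v j ≠ y j then m v else 0|) (fun _ _ => abs_nonneg _)
          (Finset.mem_univ w)
        simp only [h1, h2, ne_eq, not_false_eq_true, and_self, if_true] at this
        simp only [ne_eq] at hs hr
        linarith

/-- If the `Δ`-marginals of a nonzero integer table `m` vanish and
its degree `∑ x, max (m x) 0` equals the lower bound `2^(g-1)`, where `g` is the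
minimal cardinality of a non-face of `Δ`, then `m` only takes values in `{-1,0,1}`
(the bound is attained only by square-free binomials). -/
theorem degree_bound_attained_only_squarefree
    (n : ℕ) (X : Fin n → Type*) [∀ i, Fintype (X i)] [∀ i, DecidableEq (X i)]
    (hcard : ∀ i, 2 ≤ Fintype.card (X i))
    (Δ : Set (Finset (Fin n)))
    (hcomplex : ∀ A B : Finset (Fin n), A ⊆ B → B ∈ Δ → A ∈ Δ)
    (hempty : ∅ ∈ Δ)
    (hproper : Δ ≠ Set.univ)
    (g : ℕ)
    (hg_mem : ∃ B : Finset (Fin n), B ∉ Δ ∧ B.card = g)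
    (hg_min : ∀ B : Finset (Fin n), B ∉ Δ → g ≤ B.card)
    (m : (∀ i, X i) → ℤ) (hm : m ≠ 0)
    (hmarg : ∀ B ∈ Δ, ∀ y : (∀ i : B, X i),
      ∑ x ∈ Finset.univ.filter (fun x : (∀ i, X i) => ∀ i : B, x i = y i), m x = 0)
    (hdeg : ∑ x : (∀ i, X i), max (m x) 0 = 2 ^ (g - 1)) :
    ∀ x : (∀ i, X i), m x = -1 ∨ m x = 0 ∨ m x = 1 := by
  have hg : 1 ≤ g := by
    obtain ⟨B, hB, rfl⟩ := hg_mem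
    rw [Nat.one_le_iff_ne_zero, Finset.card_ne_zero, Finset.nonempty_iff_ne_empty]
    rintro rfl
    exact hB hempty
  have hv : AuxVanish (g - 1) m := by
    intro B hB z
    have hBΔ : B ∈ Δ := by
      by_contra hc
      have := hg_min B hc
      omega
    have := hmarg B hBΔ (fun i => z i)
    rw [Finset.sum_filter] at this
    refine Eq.trans ?_ this
    apply Finset.sum_congr rfl
    intro x _
    exact if_congr (by simp) rfl rfl
  intro x
  have ht := hv.total x
  have hn : ∑ x, |m x| = 2 ^ (g - 1 + 1) := by
    have : ∀ x, |m x| = 2 * max (m x) 0 - m x := by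
      intro x
      rcases le_total (m x) 0 with h | h
      · rw [abs_of_nonpos h, max_eq_right h]; ring
      · rw [abs_of_nonneg h, max_eq_left h]; ring
    rw [Finset.sum_congr rfl (fun x _ => this x), Finset.sum_sub_distrib, ← Finset.mul_sum,
      hdeg, ht]
    ring
  have := abs_le.mp ((aux_main (g - 1) m hm hv).2 hn x)
  omega
end

section
/- Let Δ be a simplicial complex on N = {1,…,n} and let X = {0,1}^n. The family {e_B : B ⊆ N, B ∉ Δ} is a basis (over ℝ) of the kernel of the marginal map, i.e. of the subspace {u : X → ℝ : u_B(y) = 0 for every B ∈ Δ and every y ∈ {0,1}^B}. -/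
/-- The character vector `e_B ∈ ℝ^({0,1}^n)`, `e_B x = (-1)^{|{i ∈ B : x i = 1}|}`. -/
noncomputable def eVec (n : ℕ) (B : Finset (Fin n)) : (Fin n → Bool) → ℝ :=
  fun x => (-1 : ℝ) ^ (B.filter (fun i => x i = true)).card

theorem eVec_prod (n : ℕ) (B : Finset (Fin n)) (x : Fin n → Bool) :
    eVec n B x = ∏ i ∈ B, (if x i = true then (-1 : ℝ) else 1) := by
  simp [eVec, Finset.prod_ite]

/-- Flip the coordinate `i`. -/
def flipAt {n : ℕ} (i : Fin n) (x : Fin n → Bool) : Fin n → Bool :=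
  Function.update x i (!x i)

theorem flipAt_flipAt {n : ℕ} (i : Fin n) (x : Fin n → Bool) : flipAt i (flipAt i x) = x := by
  simp [flipAt]

theorem flipAt_ne {n : ℕ} (i : Fin n) (x : Fin n → Bool) : flipAt i x ≠ x := by
  intro h
  have := congrFun h i
  simp [flipAt] at this

theorem flipAt_of_ne {n : ℕ} {i j : Fin n} (x : Fin n → Bool) (h : j ≠ i) :
    flipAt i x j = x j := by
  simp [flipAt, h]

theorem eVec_flip_notMem {n : ℕ} {B : Finset (Fin n)} {i : Fin n} (hi : i ∉ B)
    (x : Fin n → Bool) : eVec n B (flipAt i x) = eVec n B x := by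
  rw [eVec_prod, eVec_prod]
  refine Finset.prod_congr rfl fun j hj => ?_
  have hji : j ≠ i := fun h => hi (h ▸ hj)
  rw [flipAt_of_ne x hji]

theorem eVec_flip_mem {n : ℕ} {B : Finset (Fin n)} {i : Fin n} (hi : i ∈ B)
    (x : Fin n → Bool) : eVec n B (flipAt i x) = - eVec n B x := by
  rw [eVec_prod, eVec_prod, ← Finset.mul_prod_erase B _ hi, ← Finset.mul_prod_erase B _ hi,
    ← neg_mul]
  congr 1
  · cases h : x i <;> simp [flipAt, h]
  · refine Finset.prod_congr rfl fun j hj => ?_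
    rw [flipAt_of_ne x (Finset.ne_of_mem_erase hj)]

theorem sum_flip_zero {n : ℕ} (i : Fin n) (S : Finset (Fin n → Bool)) (f : (Fin n → Bool) → ℝ)
    (hS : ∀ x ∈ S, flipAt i x ∈ S) (hf : ∀ x, f (flipAt i x) = - f x) : ∑ x ∈ S, f x = 0 :=
  Finset.sum_involution (fun x _ => flipAt i x) (fun x _ => by rw [hf]; ring)
    (fun x _ _ => flipAt_ne i x) hS (fun x _ => flipAt_flipAt i x)

theorem eVec_sq {n : ℕ} (B : Finset (Fin n)) (x : Fin n → Bool) :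
    eVec n B x * eVec n B x = 1 := by
  simp [eVec, ← mul_pow]

theorem eVec_orth {n : ℕ} {A B : Finset (Fin n)} (h : A ≠ B) :
    ∑ x, eVec n A x * eVec n B x = 0 := by
  obtain ⟨i, hi⟩ : ∃ i, ¬ (i ∈ A ↔ i ∈ B) := by
    by_contra! hc
    exact h (Finset.ext hc)
  refine sum_flip_zero i _ _ (fun _ _ => Finset.mem_univ _) fun x => ?_
  by_cases hA : i ∈ A <;> by_cases hB : i ∈ B
  · exact absurd (iff_of_true hA hB) hi
  · rw [eVec_flip_mem hA, eVec_flip_notMem hB]; ring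
  · rw [eVec_flip_notMem hA, eVec_flip_mem hB]; ring
  · exact absurd (iff_of_false hA hB) hi

theorem eVec_coeff {n : ℕ} (c : Finset (Fin n) → ℝ) (B : Finset (Fin n)) :
    ∑ x, (∑ A, c A • eVec n A) x * eVec n B x = c B * 2 ^ n := by
  simp only [Finset.sum_apply, Pi.smul_apply, smul_eq_mul, Finset.sum_mul]
  rw [Finset.sum_comm, Finset.sum_eq_single B]
  · simp only [mul_assoc, eVec_sq]
    simp [mul_comm]
  · intro A _ hA
    simp only [mul_assoc]
    rw [← Finset.mul_sum, eVec_orth hA, mul_zero]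
  · simp

theorem eVec_linInd (n : ℕ) : LinearIndependent ℝ (eVec n) := by
  rw [Fintype.linearIndependent_iff]
  intro c hc B
  have h := eVec_coeff c B
  rw [hc] at h
  simpa using h.symm

theorem eVec_span (n : ℕ) : Submodule.span ℝ (Set.range (eVec n)) = ⊤ :=
  (eVec_linInd n).span_eq_top_of_card_eq_finrank' (by simp)

theorem eVec_basis_of_marginal_kernel (n : ℕ) (hn : 1 ≤ n)
    (Δ : Set (Finset (Fin n)))
    (hcomplex : ∀ A B : Finset (Fin n), A ⊆ B → B ∈ Δ → A ∈ Δ) :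
    LinearIndependent ℝ (fun B : {B : Finset (Fin n) // B ∉ Δ} => eVec n B.val) ∧
    (Submodule.span ℝ {u : (Fin n → Bool) → ℝ | ∃ B ∉ Δ, u = eVec n B} : Set ((Fin n → Bool) → ℝ))
      = {u : (Fin n → Bool) → ℝ | ∀ B ∈ Δ, ∀ y : (∀ i : B, Bool),
          ∑ x ∈ Finset.univ.filter (fun x : Fin n → Bool => ∀ i : B, x i = y i), u x = 0} := by
  refine ⟨(eVec_linInd n).comp _ Subtype.val_injective, ?_⟩
  ext u
  simp only [SetLike.mem_coe, Set.mem_ofPred_eq]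
  constructor
  · intro hu B hB y
    induction hu using Submodule.span_induction with
    | mem u hu =>
      obtain ⟨A, hA, rfl⟩ := hu
      obtain ⟨i, hiA, hiB⟩ : ∃ i ∈ A, i ∉ B := by
        by_contra! hc
        exact hA (hcomplex A B hc hB)
      refine sum_flip_zero i _ _ (fun x hx => ?_) (eVec_flip_mem hiA)
      simp only [Finset.mem_filter, Finset.mem_univ, true_and] at hx ⊢
      intro j
      have hji : (j : Fin n) ≠ i := fun h => hiB (h ▸ j.2)
      rw [flipAt_of_ne x hji, hx j]
    | zero => simp
    | add u v _ _ hu hv =>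
      simp only [Pi.add_apply]
      rw [Finset.sum_add_distrib, hu, hv, add_zero]
    | smul a u _ hu =>
      simp only [Pi.smul_apply, smul_eq_mul]
      rw [← Finset.mul_sum, hu, mul_zero]
  · intro hu
    have hmem : u ∈ Submodule.span ℝ (Set.range (eVec n)) := by rw [eVec_span]; trivial
    obtain ⟨c, rfl⟩ := (Submodule.mem_span_range_iff_exists_fun ℝ).1 hmem
    refine Submodule.sum_mem _ fun B _ => ?_
    by_cases hB : B ∈ Δ
    · have h0 : ∑ x, (∑ A, c A • eVec n A) x * eVec n B x = 0 := by
        rw [← Finset.sum_fiberwise Finset.univ (fun (x : Fin n → Bool) (i : B) => x i)]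
        refine Finset.sum_eq_zero fun y _ => ?_
        have hy := hu B hB y
        have hconst : ∀ x : Fin n → Bool, (fun i : B => x i) = y →
            eVec n B x = ∏ i : B, (if y i = true then (-1 : ℝ) else 1) := by
          rintro x rfl
          rw [eVec_prod]
          exact (Finset.prod_coe_sort B (fun i => if x i = true then (-1 : ℝ) else 1)).symm
        rw [Finset.sum_congr rfl (fun x hx => by rw [hconst x (Finset.mem_filter.1 hx).2]),
          ← Finset.sum_mul]
        simp only [funext_iff]
        rw [hy, zero_mul]
      rw [eVec_coeff] at h0
      have : c B = 0 := by simpa using h0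
      simp [this]
    · exact Submodule.smul_mem _ _ (Submodule.subset_span ⟨B, hB, rfl⟩)
end

section
/- Let N = {1,…,n}, let X_1,…,X_n be finite sets with |X_i| ≥ 2, and let X = ∏_{i∈N} X_i. Let Δ be a simplicial complex on N with Δ ≠ 2^N, let F be the set of inclusion-maximal elements (facets) of Δ, and let g = min{|B| : B ⊆ N, B ∉ Δ}. Define the exponential family E_Δ ⊆ ℝ^X as the set of all functions p_θ, where θ = (θ_F)_{F∈F} with θ_F : ∏_{i∈F} X_i → ℝ, given by p_θ(x) = exp(Σ_{F∈F} θ_F(x|_F)) / Z(θ) with Z(θ) = Σ_{x∈X} exp(Σ_{F∈F} θ_F(x|_F)). Then every probability distribution p : X → ℝ (p ≥ 0, Σ_{x∈X} p(x) = 1) with |{x : p(x) > 0}| < 2^{g−1} lies in the closure of E_Δ in ℝ^X. -/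
/-- Span of the functions that depend on at most `k` coordinates. -/
def lowOrderSpan {ι : Type*} (X : ι → Type*) (k : ℕ) : Submodule ℝ ((∀ i, X i) → ℝ) :=
  Submodule.span ℝ {f | ∃ A : Finset ι, A.card ≤ k ∧
    ∀ x y : (∀ i, X i), (∀ i ∈ A, x i = y i) → f x = f y}

open scoped Classical in
theorem lowOrderSpan_mul {ι : Type*} (X : ι → Type*) (k : ℕ) (i : ι) (q : X i → ℝ)
    (w : (∀ i, X i) → ℝ) (hw : w ∈ lowOrderSpan X k) :
    (fun x => w x * q (x i)) ∈ lowOrderSpan X (k + 1) := by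
  unfold lowOrderSpan at hw
  induction hw using Submodule.span_induction with
  | mem f hf =>
    obtain ⟨A, hA, hf⟩ := hf
    refine Submodule.subset_span ⟨insert i A, (Finset.card_insert_le _ _).trans (by omega), ?_⟩
    intro x y h
    have h1 := hf x y (fun j hj => h j (Finset.mem_insert_of_mem hj))
    have h2 := h i (Finset.mem_insert_self _ _)
    simp only [h1, h2]
  | zero =>
    have : (fun x : (∀ i, X i) => (0 : (∀ i, X i) → ℝ) x * q (x i)) = 0 := by ext; simp
    rw [this]; exact Submodule.zero_mem _
  | add f g _ _ hf hg =>
    have : (fun x : (∀ i, X i) => (f + g) x * q (x i)) =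
      (fun x => f x * q (x i)) + (fun x => g x * q (x i)) := by ext; simp [add_mul]
    rw [this]; exact Submodule.add_mem _ hf hg
  | smul c f _ hf =>
    have : (fun x : (∀ i, X i) => (c • f) x * q (x i)) =
      c • (fun x => f x * q (x i)) := by ext; simp [mul_assoc]
    rw [this]; exact Submodule.smul_mem _ _ hf

theorem lowOrderSpan_const {ι : Type*} (X : ι → Type*) (k : ℕ) (c : ℝ) :
    (fun _ => c) ∈ lowOrderSpan X k :=
  Submodule.subset_span ⟨∅, by simp, fun _ _ _ => rfl⟩

/-- Key interpolation lemma. -/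
theorem lowOrderSpan_interpolate {ι : Type*} [Fintype ι] (X : ι → Type*) [∀ i, Fintype (X i)]
    (k : ℕ) : ∀ (m : ℕ) (S : Finset (∀ i, X i)), S.card = m → S.card < 2 ^ k →
      ∀ φ : (∀ i, X i) → ℝ, ∃ v ∈ lowOrderSpan X k,
        (∀ x ∈ S, v x = φ x) ∧ (∀ x, x ∉ S → φ x < v x) := by
  classical
  have bd : ∀ φ : (∀ i, X i) → ℝ, ∃ C : ℝ, ∀ x, φ x < C := fun φ =>
    ⟨∑ x, |φ x| + 1, fun x => by
      have := Finset.single_le_sum (f := fun x => |φ x|) (fun _ _ => abs_nonneg _)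
        (Finset.mem_univ x)
      have := le_abs_self (φ x)
      linarith⟩
  have emp : ∀ (k : ℕ) (φ : (∀ i, X i) → ℝ), ∃ v ∈ lowOrderSpan X k,
        (∀ x ∈ (∅ : Finset (∀ i, X i)), v x = φ x) ∧
        (∀ x, x ∉ (∅ : Finset (∀ i, X i)) → φ x < v x) := by
    intro k φ
    obtain ⟨C, hC⟩ := bd φ
    exact ⟨_, lowOrderSpan_const X k C, by simp, fun x _ => hC x⟩
  induction k with
  | zero =>
    intro m S _ hS φ
    have : S = ∅ := by
      rw [← Finset.card_eq_zero]; simpa using hS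
    subst this
    exact emp 0 φ
  | succ k ihk =>
    intro m
    induction m using Nat.strong_induction_on with
    | _ m ihm =>
    intro S hm hS φ
    -- splitting step
    have split : ∀ (i : ι) (Q : X i → Prop), (S.filter (fun x => Q (x i))).card < 2 ^ k →
        (∃ x ∈ S, Q (x i)) → ∃ v ∈ lowOrderSpan X (k + 1),
        (∀ x ∈ S, v x = φ x) ∧ (∀ x, x ∉ S → φ x < v x) := by
      rintro i Q hQ ⟨x0, hx0, hx0Q⟩
      have hlt : (S.filter (fun x => ¬ Q (x i))).card < S.card :=
        Finset.card_lt_card (Finset.filter_ssubset.2 ⟨x0, hx0, by simpa using hx0Q⟩)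
      obtain ⟨v, hv, hv1, hv2⟩ := ihm _ (hm ▸ hlt) _ rfl (hlt.trans hS) φ
      obtain ⟨w, hw, hw1, hw2⟩ := ihk _ _ rfl hQ (fun x => φ x - v x)
      refine ⟨_, Submodule.add_mem _ hv
        (lowOrderSpan_mul X k i (fun a => if Q a then 1 else 0) w hw), ?_, ?_⟩
      · intro x hx
        by_cases h : Q (x i)
        · have := hw1 x (by simp [hx, h])
          simp [h, this]
        · have := hv1 x (by simp [hx, h])
          simp [h, this]
      · intro x hx
        by_cases h : Q (x i)
        · have := hw2 x (by simp [hx])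
          simp only [Pi.add_apply, h, if_true, mul_one]
          linarith
        · have := hv2 x (by simp [hx])
          simpa [h] using this
    rcases Nat.lt_or_ge 1 S.card with h1 | h1
    · obtain ⟨x, hx, y, hy, hxy⟩ := Finset.one_lt_card.1 h1
      obtain ⟨i, hi⟩ := Function.ne_iff.1 hxy
      have hsum := Finset.card_filter_add_card_filter_not (s := S) (fun z => z i = x i)
      rw [pow_succ] at hS
      by_cases hc : (S.filter (fun z => z i = x i)).card < 2 ^ k
      · exact split i (fun a => a = x i) hc ⟨x, hx, rfl⟩
      · exact split i (fun a => ¬ a = x i) (lt_of_eq_of_lt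
          (b := (S.filter (fun z => ¬ z i = x i)).card) (by congr) (by omega)) ⟨y, hy, fun h => hi h.symm⟩
    · have h01 : S = ∅ ∨ ∃ s, S = {s} := by
        rcases Nat.le_one_iff_eq_zero_or_eq_one.1 h1 with h | h
        · exact Or.inl (Finset.card_eq_zero.1 h)
        · exact Or.inr (Finset.card_eq_one.1 h)
      rcases h01 with rfl | ⟨s, rfl⟩
      · exact emp _ φ
      · obtain ⟨C, hC⟩ := bd (fun x => φ x - φ s)
        have hC0 : 0 < C := by simpa using hC s
        refine ⟨(fun _ => φ s) + ∑ i, fun x => C * (if x i = s i then 0 else 1),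
          Submodule.add_mem _ (lowOrderSpan_const X _ _) (Submodule.sum_mem _ fun i _ =>
            Submodule.subset_span ⟨{i}, by simp, ?_⟩), ?_, ?_⟩
        · intro x y h
          simp [h i (by simp)]
        · intro x hx
          simp only [Finset.mem_singleton] at hx
          subst hx
          simp
        · intro x hx
          simp only [Finset.mem_singleton] at hx
          obtain ⟨i, hi⟩ := Function.ne_iff.1 hx
          have := Finset.single_le_sum (f := fun i => C * (if x i = s i then 0 else 1))
            (fun i _ => by positivity) (Finset.mem_univ i)
          have h2 := hC x
          simp only [hi, if_false, mul_one] at this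
          simp only [Pi.add_apply, Finset.sum_apply]
          linarith

open scoped Classical in
theorem lowOrderSpan_le_facets {n : ℕ} (X : Fin n → Type*) [∀ i, Nonempty (X i)]
    (Δ facets : Finset (Finset (Fin n))) (k : ℕ)
    (hk : ∀ A : Finset (Fin n), A.card ≤ k → A ∈ Δ)
    (hfacets : facets = Δ.filter (fun F => ∀ B ∈ Δ, F ⊆ B → F = B))
    (v : (∀ i, X i) → ℝ) (hv : v ∈ lowOrderSpan X k) :
    ∃ θ : (F : Finset (Fin n)) → ((∀ i : F, X i) → ℝ),
      ∀ x, v x = ∑ F ∈ facets, θ F (fun i => x i) := by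
  unfold lowOrderSpan at hv
  induction hv using Submodule.span_induction with
  | mem f hf =>
    obtain ⟨A, hA, hf⟩ := hf
    obtain ⟨F, hAF, hF⟩ := Finset.exists_le_maximal Δ (hk A hA)
    have hFm : F ∈ facets := by
      rw [hfacets, Finset.mem_filter]
      exact ⟨hF.1, fun B hB h => Finset.Subset.antisymm h (hF.2 hB h)⟩
    refine ⟨fun G y => if G = F then
      f (fun i => if h : i ∈ G then y ⟨i, h⟩ else Classical.arbitrary _) else 0, fun x => ?_⟩
    rw [Finset.sum_ite_eq' facets F (fun G =>
      f (fun i => if h : i ∈ G then x i else Classical.arbitrary _))]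
    rw [if_pos hFm]
    apply hf
    intro i hi
    rw [dif_pos (hAF hi)]
  | zero => exact ⟨fun _ _ => 0, by simp⟩
  | add f g _ _ hf hg =>
    obtain ⟨a, ha⟩ := hf
    obtain ⟨b, hb⟩ := hg
    exact ⟨fun F y => a F y + b F y, fun x => by simp [ha, hb, Finset.sum_add_distrib]⟩
  | smul c f _ hf =>
    obtain ⟨a, ha⟩ := hf
    exact ⟨fun F y => c * a F y, fun x => by simp [ha, Finset.mul_sum]⟩


open scoped Classical in
/-- Let `Δ` be a proper simplicial complex on `{1,…,n}`, `g` the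
minimal cardinality of a non-face, and `E_Δ` the exponential family of the hierarchical
model with facets `F` of `Δ`.  Then every probability distribution on `∏ i, X i` whose
support has fewer than `2^(g-1)` elements lies in the closure of `E_Δ`. -/
theorem small_support_distribution_mem_closure_exponentialFamily
    (n : ℕ) (X : Fin n → Type*) [∀ i, Fintype (X i)] [∀ i, DecidableEq (X i)]
    (hcard : ∀ i, 2 ≤ Fintype.card (X i))
    (Δ : Finset (Finset (Fin n)))
    (hcomplex : ∀ A B : Finset (Fin n), A ⊆ B → B ∈ Δ → A ∈ Δ)
    (hproper : Δ ≠ Finset.univ)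
    (g : ℕ)
    (hg_mem : ∃ B : Finset (Fin n), B ∉ Δ ∧ B.card = g)
    (hg_min : ∀ B : Finset (Fin n), B ∉ Δ → g ≤ B.card)
    (facets : Finset (Finset (Fin n)))
    (hfacets : facets = Δ.filter (fun F => ∀ B ∈ Δ, F ⊆ B → F = B))
    (E : Set ((∀ i, X i) → ℝ))
    (hE : E = {p | ∃ θ : (F : Finset (Fin n)) → ((∀ i : F, X i) → ℝ),
      p = fun x => Real.exp (∑ F ∈ facets, θ F (fun i => x i)) /
        ∑ x' : (∀ i, X i), Real.exp (∑ F ∈ facets, θ F (fun i => x' i))})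
    (p : (∀ i, X i) → ℝ)
    (hp_nonneg : ∀ x, 0 ≤ p x)
    (hp_sum : ∑ x : (∀ i, X i), p x = 1)
    (hp_supp : (Finset.univ.filter (fun x : (∀ i, X i) => 0 < p x)).card < 2 ^ (g - 1)) :
    p ∈ closure E := by
  have : ∀ i, Nonempty (X i) := fun i =>
    Fintype.card_pos_iff.1 (lt_of_lt_of_le (by norm_num) (hcard i))
  set S := Finset.univ.filter (fun x : (∀ i, X i) => 0 < p x) with hS
  have hpS : ∀ x, x ∉ S → p x = 0 := fun x hx =>
    le_antisymm (by simpa [hS] using hx) (hp_nonneg x)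
  have hSne : S.Nonempty := by
    by_contra h
    rw [Finset.not_nonempty_iff_eq_empty] at h
    have : ∑ x : (∀ i, X i), p x = 0 :=
      Finset.sum_eq_zero fun x _ => hpS x (by simp [h])
    linarith
  have hg1 : 2 ≤ g := by
    by_contra h
    have : g - 1 = 0 := by omega
    rw [this] at hp_supp
    have := hSne.card_pos
    omega
  have hk : ∀ A : Finset (Fin n), A.card ≤ g - 1 → A ∈ Δ := by
    intro A hA
    by_contra h
    have := hg_min A h
    omega
  obtain ⟨v, hv, hv1, -⟩ := lowOrderSpan_interpolate X (g - 1) _ S rfl hp_supp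
    (fun x => Real.log (p x))
  obtain ⟨w, hw, hw1, hw2⟩ := lowOrderSpan_interpolate X (g - 1) _ S rfl hp_supp
    (fun x => 0)
  -- the unnormalised curve tends to `p`
  have hlim : ∀ x, Filter.Tendsto (fun t : ℝ => Real.exp (v x - t * w x)) Filter.atTop
      (nhds (p x)) := by
    intro x
    by_cases hx : x ∈ S
    · have hpos : 0 < p x := by simpa [hS] using hx
      have h1 := hv1 x hx
      have h2 := hw1 x hx
      simp only [h1, h2, mul_zero, sub_zero, Real.exp_log hpos]
      exact tendsto_const_nhds
    · rw [hpS x hx]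
      apply Real.tendsto_exp_atBot.comp
      have h1 : Filter.Tendsto (fun t : ℝ => t * w x) Filter.atTop Filter.atTop :=
        Filter.tendsto_id.atTop_mul_const (hw2 x hx)
      have h2 := Filter.tendsto_atBot_add_const_left Filter.atTop (v x)
        (Filter.tendsto_neg_atTop_atBot.comp h1)
      simpa [sub_eq_add_neg] using h2
  have hZ : Filter.Tendsto (fun t : ℝ => ∑ x : (∀ i, X i), Real.exp (v x - t * w x))
      Filter.atTop (nhds 1) := by
    rw [← hp_sum]
    exact tendsto_finsetSum _ fun x _ => hlim x
  refine mem_closure_of_tendsto (f := fun (t : ℝ) (x : (∀ i, X i)) =>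
    Real.exp (v x - t * w x) / ∑ x' : (∀ i, X i), Real.exp (v x' - t * w x'))
    (b := Filter.atTop) ?_ (Filter.Eventually.of_forall fun t => ?_)
  · rw [tendsto_pi_nhds]
    intro x
    have h := (hlim x).div hZ one_ne_zero
    rw [div_one] at h
    exact h
  · obtain ⟨θ, hθ⟩ := lowOrderSpan_le_facets X Δ facets (g - 1) hk hfacets (v - t • w)
      (Submodule.sub_mem _ hv (Submodule.smul_mem _ t hw))
    rw [hE]
    refine ⟨θ, ?_⟩
    simp only [← hθ, Pi.sub_apply, Pi.smul_apply, smul_eq_mul]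
end

section
/- Let N = {1,…,n}, let X_1,…,X_n be finite sets with |X_i| ≥ 2, and let X = ∏_{i∈N} X_i. Let Δ be a simplicial complex on N with Δ ≠ 2^N, let F be the set of facets of Δ, and let g = min{|B| : B ⊆ N, B ∉ Δ}. For x ∈ X let A_x be the vector with coordinates indexed by pairs (F, y) with F ∈ F and y ∈ ∏_{i∈F} X_i, whose (F,y)-coordinate is 1 if x|_F = y and 0 otherwise, and let Q_Δ = conv{A_x : x ∈ X} be the marginal polytope. Then Q_Δ is (2^{g−1}−1)-neighborly: for every S ⊆ X with |S| ≤ 2^{g−1}−1, the set conv{A_x : x ∈ S} is a face of Q_Δ (an extreme subset of Q_Δ: no point of conv{A_x : x ∈ S} lies in the interior of a segment of Q_Δ whose endpoints are not both in conv{A_x : x ∈ S}). -/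
open scoped Classical in
theorem mpn_hull {ι J : Type*} [Fintype ι] (A : ι → J → ℝ) (S : Finset ι) (p : J → ℝ) :
    p ∈ convexHull ℝ (A '' S) ↔ ∃ w : ι → ℝ, (∀ x, 0 ≤ w x) ∧ (∀ x, x ∉ S → w x = 0) ∧
      ∑ x, w x = 1 ∧ ∑ x, w x • A x = p := by
  constructor
  · intro hp
    have hsub : convexHull ℝ (A '' S) ⊆ {p | ∃ w : ι → ℝ, (∀ x, 0 ≤ w x) ∧
        (∀ x, x ∉ S → w x = 0) ∧ ∑ x, w x = 1 ∧ ∑ x, w x • A x = p} := by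
      apply convexHull_min
      · rintro _ ⟨x, hx, rfl⟩
        refine ⟨fun y => if y = x then 1 else 0, ?_, ?_, ?_, ?_⟩
        · intro y; dsimp only; split_ifs <;> norm_num
        · intro y hy
          have : y ≠ x := by rintro rfl; exact hy hx
          simp [this]
        · simp
        · simp
      · rintro p ⟨w, h1, h2, h3, rfl⟩ q ⟨v, k1, k2, k3, rfl⟩ a b ha hb hab
        refine ⟨fun x => a * w x + b * v x, ?_, ?_, ?_, ?_⟩
        · intro x
          have := mul_nonneg ha (h1 x)
          have := mul_nonneg hb (k1 x)
          dsimp only; linarith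
        · intro x hx; simp [h2 x hx, k2 x hx]
        · rw [Finset.sum_add_distrib, ← Finset.mul_sum, ← Finset.mul_sum, h3, k3]; linarith
        · simp only [add_smul, Finset.sum_add_distrib, Finset.smul_sum, smul_smul]
    exact hsub hp
  · rintro ⟨w, h1, h2, h3, rfl⟩
    have e1 : ∑ x ∈ S, w x = 1 := by
      rw [← h3]; exact Finset.sum_subset (Finset.subset_univ _) (fun x _ hx => h2 x hx)
    have e2 : ∑ x ∈ S, w x • A x = ∑ x, w x • A x :=
      Finset.sum_subset (Finset.subset_univ _) (fun x _ hx => by simp [h2 x hx])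
    rw [← e2]
    exact (convex_convexHull ℝ _).sum_mem (fun x _ => h1 x) e1
      (fun x hx => subset_convexHull ℝ _ ⟨x, hx, rfl⟩)

open scoped Classical in
/-- A nonzero function with vanishing marginals on all sets of size at most `k`
has at least `2 ^ k` positive values. -/
theorem mpn_pos (n : ℕ) (X : Fin n → Type*) [∀ i, Fintype (X i)] (k : ℕ) :
    ∀ u : (∀ i, X i) → ℝ,
    (∀ G : Finset (Fin n), G.card ≤ k → ∀ z : ∀ i, X i,
      ∑ x, (if ∀ i ∈ G, x i = z i then u x else 0) = 0) → u ≠ 0 →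
    2 ^ k ≤ (Finset.univ.filter (fun x => 0 < u x)).card := by
  induction k with
  | zero =>
    intro u hu hne
    obtain ⟨z, hz⟩ := Function.ne_iff.mp hne
    have h0 : ∑ x, u x = 0 := by simpa using hu ∅ (by simp) z
    obtain ⟨x, -, hx⟩ := Finset.exists_pos_of_sum_zero_of_exists_nonzero u h0
      ⟨z, Finset.mem_univ _, hz⟩
    rw [pow_zero, Nat.one_le_iff_ne_zero, Finset.card_ne_zero]
    exact ⟨x, by simpa using hx⟩
  | succ k ih =>
    intro u hu hne
    obtain ⟨z, hz⟩ := Function.ne_iff.mp hne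
    have h0 : ∑ x, u x = 0 := by simpa using hu ∅ (by simp) z
    obtain ⟨x, -, hx⟩ := Finset.exists_pos_of_sum_zero_of_exists_nonzero u h0
      ⟨z, Finset.mem_univ _, hz⟩
    obtain ⟨y, -, hy⟩ := Finset.exists_pos_of_sum_zero_of_exists_nonzero (fun x => - u x)
      (by simp [h0]) ⟨z, Finset.mem_univ _, by simpa using hz⟩
    have hxy : x ≠ y := by rintro rfl; linarith
    obtain ⟨i, hi⟩ := Function.ne_iff.mp hxy
    have slice : ∀ t : ∀ i, X i, u t ≠ 0 → 2 ^ k ≤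
        (Finset.univ.filter (fun x => 0 < (if x i = t i then u x else 0))).card := by
      intro t ht
      apply ih (fun x => if x i = t i then u x else 0)
      · intro G hG z
        by_cases hzt : i ∈ G ∧ z i ≠ t i
        · apply Finset.sum_eq_zero
          intro x _
          split_ifs with h1 h2
          · exact absurd ((h1 i hzt.1).symm.trans h2) hzt.2
          · rfl
          · rfl
        · refine Eq.trans ?_ (hu (insert i G) ((Finset.card_insert_le _ _).trans (by omega))
            (Function.update z i (t i)))
          apply Finset.sum_congr rfl
          intro x _
          rw [← ite_and]
          congr 1
          apply propext
          constructor
          · rintro ⟨h1, h2⟩ j hj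
            by_cases hji : j = i
            · subst hji; simpa using h2
            · rw [Function.update_of_ne hji]
              exact h1 j (Finset.mem_of_mem_insert_of_ne hj hji)
          · intro h
            have hxi : x i = t i := by simpa using h i (Finset.mem_insert_self _ _)
            refine ⟨fun j hj => ?_, hxi⟩
            by_cases hji : j = i
            · subst hji
              by_contra hc
              exact hzt ⟨hj, fun e => hc (hxi.trans e.symm)⟩
            · simpa [Function.update_of_ne hji] using h j (Finset.mem_insert_of_mem hj)
      · intro h
        have := congrFun h t
        simp at this
        exact ht this
    have hx' := slice x hx.ne'
    have hy' := slice y (by intro h; simp [h] at hy)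
    rw [pow_succ, mul_two]
    refine (Nat.add_le_add hx' hy').trans ?_
    rw [← Finset.card_union_of_disjoint]
    · apply Finset.card_le_card
      intro t ht
      simp only [Finset.mem_union, Finset.mem_filter, Finset.mem_univ, true_and] at ht ⊢
      rcases ht with ht | ht <;> split_ifs at ht
      · exact ht
      · exact absurd ht (lt_irrefl _)
      · exact ht
      · exact absurd ht (lt_irrefl _)
    · rw [Finset.disjoint_left]
      intro t ht ht'
      simp only [Finset.mem_filter, Finset.mem_univ, true_and] at ht ht'
      split_ifs at ht ht' with h1 h2
      · exact hi (h1.symm.trans h2)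
      all_goals first | exact absurd ht' (lt_irrefl _) | exact absurd ht (lt_irrefl _)


open scoped Classical in
/-- The marginal polytope `Q_Δ = conv{A_x : x ∈ X}` of a hierarchical
model whose minimal non-face has cardinality `g` is `(2^(g-1)-1)`-neighborly: for every
set `S` of at most `2^(g-1)-1` configurations, `conv{A_x : x ∈ S}` is a face (an extreme
subset) of `Q_Δ`. -/
theorem marginal_polytope_neighborly
    (n : ℕ) (X : Fin n → Type*) [∀ i, Fintype (X i)] [∀ i, DecidableEq (X i)]
    (hcard : ∀ i, 2 ≤ Fintype.card (X i))
    (Δ : Finset (Finset (Fin n)))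
    (hcomplex : ∀ A B : Finset (Fin n), A ⊆ B → B ∈ Δ → A ∈ Δ)
    (hproper : Δ ≠ Finset.univ)
    (g : ℕ)
    (hg_mem : ∃ B : Finset (Fin n), B ∉ Δ ∧ B.card = g)
    (hg_min : ∀ B : Finset (Fin n), B ∉ Δ → g ≤ B.card)
    (facets : Finset (Finset (Fin n)))
    (hfacets : facets = Δ.filter (fun F => ∀ B ∈ Δ, F ⊆ B → F = B))
    (A : (∀ i, X i) →
      (Σ F : {F : Finset (Fin n) // F ∈ facets}, (∀ i : (F.val : Finset (Fin n)), X i)) → ℝ)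
    (hA : A = fun x Fy => if ∀ i : (Fy.1.val : Finset (Fin n)), x i = Fy.2 i then 1 else 0) :
    ∀ S : Finset (∀ i, X i), S.card ≤ 2 ^ (g - 1) - 1 →
      IsExtreme ℝ (convexHull ℝ (Set.range A)) (convexHull ℝ (A '' S)) := by

  intro S hS
  have hrange : Set.range A = A '' ((Finset.univ : Finset (∀ i, X i)) : Set (∀ i, X i)) := by simp
  rw [hrange]
  refine ⟨convexHull_mono (Set.image_mono (by simp)), ?_⟩
  intro p hp q hq r hr hrpq
  obtain ⟨wr, r1, r2, r3, r4⟩ := (mpn_hull A S r).1 hr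
  obtain ⟨wp, p1, -, p3, p4⟩ := (mpn_hull A _ p).1 hp
  obtain ⟨wq, q1, -, q3, q4⟩ := (mpn_hull A _ q).1 hq
  obtain ⟨a, b, ha, hb, hab, hrab⟩ := hrpq
  have hg : 1 ≤ g := by
    by_contra hg0
    have : g = 0 := by omega
    subst this
    have : S = ∅ := by simpa using hS
    subst this
    simp at hr
  have hu : ∑ x, (wr x - a * wp x - b * wq x) • A x = 0 := by
    simp only [sub_smul, Finset.sum_sub_distrib, mul_smul, ← Finset.smul_sum]
    rw [r4, p4, q4, ← hrab]; abel
  have key : (fun x => wr x - a * wp x - b * wq x) = 0 := by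
    by_contra hne
    have hpos := mpn_pos n X (g - 1) _ ?_ hne
    · have hle : (Finset.univ.filter (fun x => 0 < wr x - a * wp x - b * wq x)).card ≤ S.card := by
        apply Finset.card_le_card
        intro x hx
        by_contra hxS
        simp only [Finset.mem_filter, Finset.mem_univ, true_and, r2 x hxS] at hx
        have := mul_nonneg ha.le (p1 x)
        have := mul_nonneg hb.le (q1 x)
        linarith
      have : 0 < 2 ^ (g - 1) := by positivity
      omega
    · intro G hG z
      have hGΔ : G ∈ Δ := by
        by_contra h
        have := hg_min G h
        omega
      obtain ⟨F, hGF, hF⟩ := Δ.exists_le_maximal hGΔ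
      have hFf : F ∈ facets := by
        rw [hfacets, Finset.mem_filter]
        exact ⟨hF.prop, fun B hB hFB => hF.eq_of_le hB hFB⟩
      have hGF' : ∀ i ∈ G, i ∈ F := fun i hi => hGF hi
      rw [← Finset.sum_fiberwise (s := Finset.univ) (g := fun x : (∀ i, X i) => F.restrict x)]
      apply Finset.sum_eq_zero
      intro y _
      have hy : ∑ x with F.restrict x = y, (wr x - a * wp x - b * wq x) = 0 := by
        have h1 := congrFun hu ⟨⟨F, hFf⟩, y⟩
        rw [Finset.sum_apply] at h1
        rw [Finset.sum_filter]
        refine Eq.trans ?_ h1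
        apply Finset.sum_congr rfl
        intro x _
        have : (F.restrict x = y) ↔ ∀ i : F, x i = y i := by
          rw [funext_iff]; rfl
        simp only [this, hA, Pi.smul_apply, smul_eq_mul, mul_ite, mul_one, mul_zero]
      by_cases hyz : ∀ i (hi : i ∈ G), y ⟨i, hGF' i hi⟩ = z i
      · refine Eq.trans ?_ hy
        apply Finset.sum_congr rfl
        intro x hx
        simp only [Finset.mem_filter, Finset.mem_univ, true_and] at hx
        subst hx
        exact if_pos hyz
      · apply Finset.sum_eq_zero
        intro x hx
        simp only [Finset.mem_filter, Finset.mem_univ, true_and] at hx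
        subst hx
        exact if_neg hyz
  refine (mpn_hull A S p).2 ⟨wp, p1, fun x hx => ?_, p3, p4⟩
  have h := congrFun key x
  simp only [r2 x hx, Pi.zero_apply] at h
  have h1 := mul_nonneg ha.le (p1 x)
  have h2 := mul_nonneg hb.le (q1 x)
  have h3 : a * wp x = 0 := by linarith
  exact (mul_eq_zero.1 h3).resolve_left ha.ne'
end

section
/- Let X = {0,1}^n, let G ⊆ N = {1,…,n} be nonempty, and let y ∈ {0,1}^{N∖G}. Define m_G^y : X → ℤ by m_G^y(x) = 2^{n−|G|}·(−1)^{E(G,x)} if x|_{N∖G} = y and m_G^y(x) = 0 otherwise, where E(G,x) = |{i ∈ G : x_i = 1}|. Then all marginals of m_G^y over sets not containing G vanish: for every B ⊆ N with G ⊄ B and every z ∈ {0,1}^B, Σ_{x : x|_B = z} m_G^y(x) = 0. -/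
/-- The Markov move `m_G^y : {0,1}^n → ℤ` supported on the cylinder `{x : x|_{N∖G} = y}`,
with value `2^(n-|G|)·(-1)^{|{i ∈ G : x i = 1}|}` there. -/
def moveGy (n : ℕ) (G : Finset (Fin n)) (y : ∀ _ : (Gᶜ : Finset (Fin n)), Bool) :
    (Fin n → Bool) → ℤ :=
  fun x =>
    if ∀ i : (Gᶜ : Finset (Fin n)), x i = y i then
      2 ^ (n - G.card) * (-1) ^ (G.filter (fun i => x i = true)).card
    else 0

/-- All marginals of the move `m_G^y` over sets `B` not containing `G`
vanish. -/
theorem moveGy_marginals_vanish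
    (n : ℕ) (G : Finset (Fin n)) (hG : G.Nonempty)
    (y : ∀ _ : (Gᶜ : Finset (Fin n)), Bool) :
    ∀ B : Finset (Fin n), ¬ G ⊆ B → ∀ z : (∀ _ : B, Bool),
      ∑ x ∈ Finset.univ.filter (fun x : Fin n → Bool => ∀ i : B, x i = z i),
        moveGy n G y x = 0 := by
  intro B hB z
  obtain ⟨j, hjG, hjB⟩ := Finset.not_subset.mp hB
  have hsign : ∀ x : Fin n → Bool,
      ((-1 : ℤ)) ^ (G.filter (fun i => x i = true)).card
        = ∏ i ∈ G, (if x i = true then (-1 : ℤ) else 1) := by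
    intro x
    rw [Finset.prod_ite]
    simp
  have hne : ∀ (x : Fin n → Bool) (i : Fin n), i ≠ j →
      Function.update x j (!x j) i = x i := by
    intro x i hi
    exact Function.update_of_ne hi _ _
  have hflip : ∀ x : Fin n → Bool,
      moveGy n G y x + moveGy n G y (Function.update x j (!x j)) = 0 := by
    intro x
    have hc : (∀ i : (Gᶜ : Finset (Fin n)), Function.update x j (!x j) i = y i) ↔
        (∀ i : (Gᶜ : Finset (Fin n)), x i = y i) := by
      refine forall_congr' fun i => ?_
      rw [hne x i]
      rintro h
      exact (Finset.mem_compl.mp i.2) (h ▸ hjG)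
    unfold moveGy
    simp only [hc]
    split_ifs
    · rw [hsign, hsign, ← Finset.mul_prod_erase G _ hjG, ← Finset.mul_prod_erase G _ hjG]
      have : ∏ i ∈ G.erase j, (if Function.update x j (!x j) i = true then (-1 : ℤ) else 1)
          = ∏ i ∈ G.erase j, (if x i = true then (-1 : ℤ) else 1) := by
        refine Finset.prod_congr rfl fun i hi => ?_
        rw [hne x i (Finset.ne_of_mem_erase hi)]
      rw [this, Function.update_self]
      cases x j <;> simp
    · simp
  refine Finset.sum_involution (fun x _ => Function.update x j (!x j)) ?_ ?_ ?_ ?_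
  · intro x _
    exact hflip x
  · intro x _ _ h
    have := congrFun h j
    simp at this
  · intro x hx
    simp only [Finset.mem_filter, Finset.mem_univ, true_and] at hx ⊢
    intro i
    rw [hne x i, hx i]
    intro h
    exact hjB (h ▸ i.2)
  · intro x _
    simp
end

section
/- Let X = {0,1}^n, let G ⊆ N = {1,…,n} be nonempty with g = |G|, and let y ∈ {0,1}^{N∖G}. Define m_G^y : X → ℤ by m_G^y(x) = 2^{n−g}·(−1)^{E(G,x)} if x|_{N∖G} = y and m_G^y(x) = 0 otherwise, where E(G,x) = |{i ∈ G : x_i = 1}|. Then |{x ∈ X : m_G^y(x) > 0}| = 2^{g−1} and |{x ∈ X : m_G^y(x) < 0}| = 2^{g−1}; in particular the lower bound 2^{g−1} on the cardinality of the positive and negative supports of kernel elements of the model Δ_{/G} = {B ⊆ N : G ⊄ B} (whose minimal non-face is G, of cardinality g) is attained. -/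
theorem moveGy_flip (n : ℕ) (G : Finset (Fin n)) (y : ∀ _ : (Gᶜ : Finset (Fin n)), Bool)
    (a : Fin n) (ha : a ∈ G) (x : Fin n → Bool) :
    moveGy n G y (Function.update x a (!x a)) = - moveGy n G y x := by
  have hc : (∀ i : (Gᶜ : Finset (Fin n)), Function.update x a (!x a) i = y i) ↔
      (∀ i : (Gᶜ : Finset (Fin n)), x i = y i) := by
    refine forall_congr' fun i => ?_
    have hi : (i : Fin n) ≠ a := by
      intro h
      have := i.2
      rw [Finset.mem_compl, h] at this
      exact this ha
    rw [Function.update_of_ne hi]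
  have key : ∀ z : Fin n → Bool, ((-1 : ℤ)) ^ (G.filter (fun i => z i = true)).card
      = (if z a = true then -1 else 1) * ∏ i ∈ G.erase a, (if z i = true then (-1 : ℤ) else 1) := by
    intro z
    rw [Finset.mul_prod_erase G (fun i => if z i = true then (-1 : ℤ) else 1) ha,
      Finset.prod_ite]
    simp
  have hp : ∏ i ∈ G.erase a, (if Function.update x a (!x a) i = true then (-1 : ℤ) else 1)
      = ∏ i ∈ G.erase a, (if x i = true then (-1 : ℤ) else 1) := by
    refine Finset.prod_congr rfl fun i hi => ?_
    rw [Function.update_of_ne (Finset.ne_of_mem_erase hi)]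
  unfold moveGy
  simp only [hc]
  split_ifs
  · rw [key, key, hp, Function.update_self]
    cases x a <;> simp
  · simp

theorem moveGy_cylinder_card (n : ℕ) (G : Finset (Fin n))
    (y : ∀ _ : (Gᶜ : Finset (Fin n)), Bool) :
    (Finset.univ.filter (fun x : Fin n → Bool =>
      ∀ i : (Gᶜ : Finset (Fin n)), x i = y i)).card = 2 ^ G.card := by
  rw [← Finset.card_powerset]
  refine Finset.card_bij' (fun x _ => G.filter (fun i => x i = true))
    (fun S _ i => if h : i ∈ Gᶜ then y ⟨i, h⟩ else decide (i ∈ S)) ?_ ?_ ?_ ?_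
  · intro x _
    simp
  · intro S _
    simp only [Finset.mem_filter, Finset.mem_univ, true_and]
    intro i
    rw [dif_pos i.2]
  · intro x hx
    simp only [Finset.mem_filter, Finset.mem_univ, true_and] at hx
    funext i
    by_cases h : i ∈ Gᶜ
    · simp only [dif_pos h]
      exact (hx ⟨i, h⟩).symm
    · simp only [dif_neg h]
      have : i ∈ G := by simpa using h
      simp [this]
  · intro S hS
    rw [Finset.mem_powerset] at hS
    ext i
    by_cases h : i ∈ G
    · simp [h]
    · have : i ∉ S := fun h' => h (hS h')
      simp [h, this]

/-- The move `m_G^y` has exactly `2^(g-1)` positive and exactly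
`2^(g-1)` negative components, where `g = |G|`; hence the lower bound `2^(g-1)` on the
positive and negative supports of kernel elements of the model `Δ_{/G}` is attained. -/
theorem moveGy_support_cardinalities
    (n : ℕ) (G : Finset (Fin n)) (hG : G.Nonempty) (g : ℕ) (hg : G.card = g)
    (y : ∀ _ : (Gᶜ : Finset (Fin n)), Bool) :
    (Finset.univ.filter (fun x : Fin n → Bool => 0 < moveGy n G y x)).card = 2 ^ (g - 1) ∧
    (Finset.univ.filter (fun x : Fin n → Bool => moveGy n G y x < 0)).card = 2 ^ (g - 1) := by
  obtain ⟨a, ha⟩ := hG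
  have heq : (Finset.univ.filter (fun x : Fin n → Bool => 0 < moveGy n G y x)).card =
      (Finset.univ.filter (fun x : Fin n → Bool => moveGy n G y x < 0)).card := by
    refine Finset.card_bij' (fun x _ => Function.update x a (!x a))
      (fun x _ => Function.update x a (!x a)) ?_ ?_ ?_ ?_
    · intro x hx
      simpa [moveGy_flip n G y a ha x] using hx
    · intro x hx
      simpa [moveGy_flip n G y a ha x] using hx
    · intro x _
      simp
    · intro x _
      simp
  have hsum : (Finset.univ.filter (fun x : Fin n → Bool => 0 < moveGy n G y x)).card +
      (Finset.univ.filter (fun x : Fin n → Bool => moveGy n G y x < 0)).card = 2 ^ G.card := by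
    rw [← moveGy_cylinder_card n G y, ← Finset.card_union_of_disjoint]
    · congr 1
      ext x
      simp only [Finset.mem_union, Finset.mem_filter, Finset.mem_univ, true_and]
      rw [or_comm, ← ne_iff_lt_or_gt]
      unfold moveGy
      split_ifs with h
      · simp only [h, implies_true, iff_true]
        exact mul_ne_zero (by positivity) (pow_ne_zero _ (by norm_num))
      · simp only [h, ne_eq, not_true_eq_false]
    · rw [Finset.disjoint_filter]
      intro x _ h1 h2
      exact absurd h1 h2.not_gt
  obtain ⟨k, rfl⟩ : ∃ k, g = k + 1 :=
    ⟨g - 1, by have := Finset.card_pos.mpr ⟨a, ha⟩; omega⟩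
  rw [hg, pow_succ] at hsum
  rw [Nat.add_sub_cancel]
  omega
end
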